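/- Let A be a unital Banach algebra over ℂ, let L_1, …, L_n ∈ A, let h_1, …, h_n ≥ 0 satisfy ‖L_j‖ ≤ 2h_j, and let p_1, …, p_n ∈ (0,1]. For b : Fin n → Bool define T(b) = Σ_j L̂_j(b)³ + (3/2) Σ_{j≠k} ( L̂_j(b)² L̂_k(b) + L̂_j(b) L̂_k(b)² ) + 3 Σ_{1 ≤ j < k < l ≤ n} ( L̂_j(b) L̂_k(b) L̂_l(b) + L̂_l(b) L̂_k(b) L̂_j(b) ). Then ‖ (Σ_j L_j)³ − E[T] ‖ ≤ 8 Σ_j (1/p_j² − 1) h_j³ + 8 Σ_{j≠k} (3/p_j − 1) h_j² h_k + 64 Σ_{1 ≤ j < k < l ≤ n} h_j h_k h_l. -/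

import Mathlib

/-- The weight of a sparsification pattern `b`: `w(b) = ∏_j (if b j then p_j else 1 − p_j)`. -/
noncomputable def sparWeight {n : ℕ} (p : Fin n → ℝ) (b : Fin n → Bool) : ℝ :=
  ∏ j : Fin n, (if b j then p j else 1 - p j)

/-- The sparsified term: `L̂_j(b) = (1/p_j) • L_j` if `b j` and `0` otherwise. -/
noncomputable def sparTerm {A : Type*} [NormedRing A] [NormedAlgebra ℂ A] {n : ℕ}
    (L : Fin n → A) (p : Fin n → ℝ) (b : Fin n → Bool) (j : Fin n) : A :=
  if b j then (1 / p j) • L j else 0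

/-- The expectation over sparsification patterns: `E[g] = Σ_b w(b) • g(b)`. -/
noncomputable def sparExp {A : Type*} [NormedRing A] [NormedAlgebra ℂ A] {n : ℕ}
    (p : Fin n → ℝ) (g : (Fin n → Bool) → A) : A :=
  ∑ b : Fin n → Bool, sparWeight p b • g b

/-- The third-order Taylor coefficient `3!·Â₃` of the symmetrized Trotter product
of the sparsified terms. -/
noncomputable def sparT {A : Type*} [NormedRing A] [NormedAlgebra ℂ A] {n : ℕ}
    (L : Fin n → A) (p : Fin n → ℝ) (b : Fin n → Bool) : A :=
  (∑ j : Fin n, (sparTerm L p b j) ^ 3)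
    + (3 / 2 : ℝ) • (∑ j : Fin n, ∑ k : Fin n,
        (if j ≠ k then
          (sparTerm L p b j) ^ 2 * sparTerm L p b k
            + sparTerm L p b j * (sparTerm L p b k) ^ 2
        else 0))
    + (3 : ℝ) • (∑ j : Fin n, ∑ k : Fin n, ∑ l : Fin n,
        (if j < k ∧ k < l then
          sparTerm L p b j * sparTerm L p b k * sparTerm L p b l
            + sparTerm L p b l * sparTerm L p b k * sparTerm L p b j
        else 0))

/-- Moments of the independent Bernoulli pattern. -/
lemma spar_moment {n : ℕ} (p : Fin n → ℝ) (S : Finset (Fin n)) :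
    ∑ b : Fin n → Bool, sparWeight p b * ∏ i ∈ S, (if b i then (1 : ℝ) else 0)
      = ∏ i ∈ S, p i := by
  have h1 : ∀ b : Fin n → Bool,
      sparWeight p b * ∏ i ∈ S, (if b i then (1 : ℝ) else 0)
        = ∏ i : Fin n, ((if b i then p i else 1 - p i) *
            (if i ∈ S then (if b i then (1 : ℝ) else 0) else 1)) := by
    intro b
    rw [Finset.prod_mul_distrib, sparWeight]
    congr 1
    rw [Finset.prod_ite_mem, Finset.univ_inter]
  simp_rw [h1]
  have h2 := (Fintype.prod_sum (fun (i : Fin n) (c : Bool) =>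
    ((if c then p i else 1 - p i) * (if i ∈ S then (if c then (1 : ℝ) else 0) else 1))))
  rw [← h2]
  have h3 : ∀ i : Fin n, (∑ c : Bool, ((if c then p i else 1 - p i) *
      (if i ∈ S then (if c then (1 : ℝ) else 0) else 1))) = if i ∈ S then p i else 1 := by
    intro i
    by_cases hi : i ∈ S <;> simp [hi]
  simp_rw [h3]
  rw [Finset.prod_ite_mem, Finset.univ_inter]

section spar
variable {A : Type*} [NormedRing A] [NormedAlgebra ℂ A] {n : ℕ}

lemma sparTerm_eq (L : Fin n → A) (p : Fin n → ℝ) (b : Fin n → Bool) (j : Fin n) :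
    sparTerm L p b j = ((1 / p j) * (if b j then (1 : ℝ) else 0)) • L j := by
  unfold sparTerm
  split_ifs <;> simp

lemma sparExp_add (p : Fin n → ℝ) (f g : (Fin n → Bool) → A) :
    sparExp p (fun b => f b + g b) = sparExp p f + sparExp p g := by
  simp [sparExp, smul_add, Finset.sum_add_distrib]

lemma sparExp_smul (p : Fin n → ℝ) (c : ℝ) (f : (Fin n → Bool) → A) :
    sparExp p (fun b => c • f b) = c • sparExp p f := by
  simp only [sparExp, Finset.smul_sum]
  exact Finset.sum_congr rfl fun b _ => smul_comm _ _ _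

lemma sparExp_sum {ι : Type*} (s : Finset ι) (p : Fin n → ℝ) (f : ι → (Fin n → Bool) → A) :
    sparExp p (fun b => ∑ i ∈ s, f i b) = ∑ i ∈ s, sparExp p (f i) := by
  simp only [sparExp, Finset.smul_sum]
  exact Finset.sum_comm

lemma sparExp_ite (p : Fin n → ℝ) (P : Prop) [Decidable P] (f : (Fin n → Bool) → A) :
    sparExp p (fun b => if P then f b else 0) = if P then sparExp p f else 0 := by
  split_ifs <;> simp [sparExp]

lemma sparExp_moment (p : Fin n → ℝ) (S : Finset (Fin n)) (c : ℝ) (X : A) :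
    sparExp p (fun b => (c * ∏ i ∈ S, (if b i then (1 : ℝ) else 0)) • X)
      = (c * ∏ i ∈ S, p i) • X := by
  rw [← spar_moment, Finset.mul_sum, Finset.sum_smul, sparExp]
  refine Finset.sum_congr rfl fun b _ => ?_
  rw [smul_smul]
  congr 1
  ring

lemma sparExp_cube (L : Fin n → A) (p : Fin n → ℝ) (hp : ∀ j, 0 < p j) (j : Fin n) :
    sparExp p (fun b => sparTerm L p b j ^ 3) = (1 / p j ^ 2) • L j ^ 3 := by
  have h := sparExp_moment p {j} ((1 / p j) ^ 3) (L j ^ 3)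
  have e : (fun b => sparTerm L p b j ^ 3) = (fun b : Fin n → Bool =>
      ((1 / p j) ^ 3 * ∏ i ∈ {j}, (if b i then (1 : ℝ) else 0)) • L j ^ 3) := by
    funext b
    rw [sparTerm_eq, smul_pow, Finset.prod_singleton]
    congr 1
    split_ifs <;> simp
  rw [e, h, Finset.prod_singleton]
  congr 1
  have := (hp j).ne'
  field_simp

lemma sparExp_sq_mul (L : Fin n → A) (p : Fin n → ℝ) (hp : ∀ j, 0 < p j) (j k : Fin n)
    (hjk : j ≠ k) :
    sparExp p (fun b => sparTerm L p b j ^ 2 * sparTerm L p b k)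
      = (1 / p j) • (L j ^ 2 * L k) := by
  have h := sparExp_moment p {j, k} ((1 / p j) ^ 2 * (1 / p k)) (L j ^ 2 * L k)
  have e : (fun b => sparTerm L p b j ^ 2 * sparTerm L p b k) = (fun b : Fin n → Bool =>
      (((1 / p j) ^ 2 * (1 / p k)) * ∏ i ∈ {j, k}, (if b i then (1 : ℝ) else 0)) •
        (L j ^ 2 * L k)) := by
    funext b
    rw [sparTerm_eq, sparTerm_eq, smul_pow, Finset.prod_pair hjk, smul_mul_smul_comm]
    congr 1
    split_ifs <;> simp
  rw [e, h, Finset.prod_pair hjk]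
  congr 1
  have := (hp j).ne'
  have := (hp k).ne'
  field_simp

lemma sparExp_mul_sq (L : Fin n → A) (p : Fin n → ℝ) (hp : ∀ j, 0 < p j) (j k : Fin n)
    (hjk : j ≠ k) :
    sparExp p (fun b => sparTerm L p b j * sparTerm L p b k ^ 2)
      = (1 / p k) • (L j * L k ^ 2) := by
  have h := sparExp_moment p {j, k} ((1 / p j) * (1 / p k) ^ 2) (L j * L k ^ 2)
  have e : (fun b => sparTerm L p b j * sparTerm L p b k ^ 2) = (fun b : Fin n → Bool =>
      (((1 / p j) * (1 / p k) ^ 2) * ∏ i ∈ {j, k}, (if b i then (1 : ℝ) else 0)) •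
        (L j * L k ^ 2)) := by
    funext b
    rw [sparTerm_eq, sparTerm_eq, smul_pow, Finset.prod_pair hjk, smul_mul_smul_comm]
    congr 1
    split_ifs <;> simp
  rw [e, h, Finset.prod_pair hjk]
  congr 1
  have := (hp j).ne'
  have := (hp k).ne'
  field_simp

lemma sparExp_triple (L : Fin n → A) (p : Fin n → ℝ) (hp : ∀ j, 0 < p j) (j k l : Fin n)
    (hjk : j ≠ k) (hjl : j ≠ l) (hkl : k ≠ l) :
    sparExp p (fun b => sparTerm L p b j * sparTerm L p b k * sparTerm L p b l)
      = L j * L k * L l := by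
  have h := sparExp_moment p {j, k, l} ((1 / p j) * (1 / p k) * (1 / p l)) (L j * L k * L l)
  have hm : ∀ f : Fin n → ℝ, ∏ i ∈ ({j, k, l} : Finset (Fin n)), f i = f j * (f k * f l) := by
    intro f
    rw [Finset.prod_insert (by simp [hjk, hjl]), Finset.prod_pair hkl]
  have e : (fun b => sparTerm L p b j * sparTerm L p b k * sparTerm L p b l) =
      (fun b : Fin n → Bool =>
      (((1 / p j) * (1 / p k) * (1 / p l)) *
        ∏ i ∈ {j, k, l}, (if b i then (1 : ℝ) else 0)) • (L j * L k * L l)) := by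
    funext b
    rw [sparTerm_eq, sparTerm_eq, sparTerm_eq, hm, smul_mul_smul_comm, smul_mul_smul_comm]
    congr 1
    ring
  rw [e, h, hm]
  have := (hp j).ne'
  have := (hp k).ne'
  have := (hp l).ne'
  have e2 : 1 / p j * (1 / p k) * (1 / p l) * (p j * (p k * p l)) = 1 := by
    field_simp
  rw [e2, one_smul]

lemma sparExp_T (L : Fin n → A) (p : Fin n → ℝ) (hp : ∀ j, 0 < p j) :
    sparExp p (fun b => sparT L p b) =
      (∑ j, (1 / p j ^ 2) • L j ^ 3)
      + (3 / 2 : ℝ) • (∑ j, ∑ k, (if j ≠ k then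
          (1 / p j) • (L j ^ 2 * L k) + (1 / p k) • (L j * L k ^ 2) else 0))
      + (3 : ℝ) • (∑ j, ∑ k, ∑ l, (if j < k ∧ k < l then
          L j * L k * L l + L l * L k * L j else 0)) := by
  unfold sparT
  rw [sparExp_add, sparExp_add, sparExp_smul, sparExp_smul]
  congr 1
  · congr 1
    · rw [sparExp_sum]
      exact Finset.sum_congr rfl fun j _ => sparExp_cube L p hp j
    · congr 1
      rw [sparExp_sum]
      refine Finset.sum_congr rfl fun j _ => ?_
      rw [sparExp_sum]
      refine Finset.sum_congr rfl fun k _ => ?_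
      rw [sparExp_ite]
      split_ifs with hjk
      · rw [sparExp_add, sparExp_sq_mul L p hp j k hjk, sparExp_mul_sq L p hp j k hjk]
      · rfl
  · congr 1
    rw [sparExp_sum]
    refine Finset.sum_congr rfl fun j _ => ?_
    rw [sparExp_sum]
    refine Finset.sum_congr rfl fun k _ => ?_
    rw [sparExp_sum]
    refine Finset.sum_congr rfl fun l _ => ?_
    rw [sparExp_ite]
    split_ifs with hh
    · have h1 := hh.1.ne
      have h2 := hh.2.ne
      have h3 := (hh.1.trans hh.2).ne
      rw [sparExp_add, sparExp_triple L p hp j k l h1 h3 h2,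
        sparExp_triple L p hp l k j h2.symm h3.symm h1.symm]
    · rfl
end spar

/-- Splitting a triple sum according to the coincidence/order pattern of the indices. -/
lemma triple_split {B : Type*} [AddCommGroup B] {n : ℕ} (F : Fin n → Fin n → Fin n → B) :
    ∑ j, ∑ k, ∑ l, F j k l =
      (∑ j, F j j j)
      + (∑ j, ∑ k, if j ≠ k then F j j k + F j k j + F k j j else 0)
      + ∑ j, ∑ k, ∑ l, if j < k ∧ k < l then
          F j k l + F l k j + F j l k + F k j l + F k l j + F l j k else 0 := by
  have key : ∀ j k l : Fin n, F j k l =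
      (if j = k then if j = l then F j k l else 0 else 0)
      + (if j = k then if j ≠ l then F j k l else 0 else 0)
      + (if j = l then if j ≠ k then F j k l else 0 else 0)
      + (if k = l then if k ≠ j then F j k l else 0 else 0)
      + (if j < k ∧ k < l then F j k l else 0)
      + (if l < k ∧ k < j then F j k l else 0)
      + (if j < l ∧ l < k then F j k l else 0)
      + (if k < j ∧ j < l then F j k l else 0)
      + (if l < j ∧ j < k then F j k l else 0)
      + (if k < l ∧ l < j then F j k l else 0) := by
    intro j k l
    rcases lt_trichotomy j k with h1 | h1 | h1 <;>
    rcases lt_trichotomy k l with h2 | h2 | h2 <;>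
    rcases lt_trichotomy j l with h3 | h3 | h3 <;>
    first
      | (exfalso; omega)
      | (subst_vars; simp [*, ne_of_lt, ne_of_gt, not_lt_of_gt])
  have s1 : ∑ j, ∑ k, ∑ l, (if j = k then if j = l then F j k l else 0 else 0)
      = ∑ j, F j j j := by
    refine Finset.sum_congr rfl fun j _ => ?_
    rw [Finset.sum_eq_single j (by intro b _ hb; simp [hb.symm]) (by simp)]
    simp
  have s2 : ∑ j, ∑ k, ∑ l, (if j = k then if j ≠ l then F j k l else 0 else 0)
      = ∑ j, ∑ k, if j ≠ k then F j j k else 0 := by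
    refine Finset.sum_congr rfl fun j _ => ?_
    rw [Finset.sum_eq_single j (by intro b _ hb; simp [hb.symm]) (by simp)]
    simp
  have s3 : ∑ j, ∑ k, ∑ l, (if j = l then if j ≠ k then F j k l else 0 else 0)
      = ∑ j, ∑ k, if j ≠ k then F j k j else 0 := by
    refine Finset.sum_congr rfl fun j _ => Finset.sum_congr rfl fun k _ => ?_
    simp
  have s4 : ∑ j, ∑ k, ∑ l, (if k = l then if k ≠ j then F j k l else 0 else 0)
      = ∑ j, ∑ k, if j ≠ k then F k j j else 0 := by
    rw [Finset.sum_comm]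
    refine Finset.sum_congr rfl fun j _ => Finset.sum_congr rfl fun k _ => ?_
    simp
  -- relabelling of triple sums
  have sw1 : ∀ G : Fin n → Fin n → Fin n → B,
      ∑ j, ∑ k, ∑ l, G j k l = ∑ j, ∑ k, ∑ l, G k j l := fun G => Finset.sum_comm
  have sw2 : ∀ G : Fin n → Fin n → Fin n → B,
      ∑ j, ∑ k, ∑ l, G j k l = ∑ j, ∑ k, ∑ l, G j l k :=
    fun G => Finset.sum_congr rfl fun j _ => Finset.sum_comm
  have t1 := sw2 (fun j k l => if j < l ∧ l < k then F j k l else 0)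
  have t2 := sw1 (fun j k l => if k < j ∧ j < l then F j k l else 0)
  have t3 : ∑ j, ∑ k, ∑ l, (if l < k ∧ k < j then F j k l else 0)
      = ∑ j, ∑ k, ∑ l, (if j < k ∧ k < l then F l k j else 0) := by
    rw [sw1, sw2, sw1]
  have t4 : ∑ j, ∑ k, ∑ l, (if l < j ∧ j < k then F j k l else 0)
      = ∑ j, ∑ k, ∑ l, (if j < k ∧ k < l then F k l j else 0) := by
    rw [sw2, sw1]
  have t5 : ∑ j, ∑ k, ∑ l, (if k < l ∧ l < j then F j k l else 0)
      = ∑ j, ∑ k, ∑ l, (if j < k ∧ k < l then F l j k else 0) := by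
    rw [sw1, sw2]
  have d2 : (∑ j, ∑ k, if j ≠ k then F j j k + F j k j + F k j j else 0)
      = (∑ j, ∑ k, if j ≠ k then F j j k else 0) + (∑ j, ∑ k, if j ≠ k then F j k j else 0)
        + (∑ j, ∑ k, if j ≠ k then F k j j else 0) := by
    simp only [← Finset.sum_add_distrib]
    refine Finset.sum_congr rfl fun j _ => Finset.sum_congr rfl fun k _ => ?_
    split_ifs <;> simp
  have d3 : (∑ j, ∑ k, ∑ l, if j < k ∧ k < l then
          F j k l + F l k j + F j l k + F k j l + F k l j + F l j k else 0)
      = (∑ j, ∑ k, ∑ l, if j < k ∧ k < l then F j k l else 0)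
        + (∑ j, ∑ k, ∑ l, if j < k ∧ k < l then F l k j else 0)
        + (∑ j, ∑ k, ∑ l, if j < k ∧ k < l then F j l k else 0)
        + (∑ j, ∑ k, ∑ l, if j < k ∧ k < l then F k j l else 0)
        + (∑ j, ∑ k, ∑ l, if j < k ∧ k < l then F k l j else 0)
        + (∑ j, ∑ k, ∑ l, if j < k ∧ k < l then F l j k else 0) := by
    simp only [← Finset.sum_add_distrib]
    refine Finset.sum_congr rfl fun j _ => Finset.sum_congr rfl fun k _ =>
      Finset.sum_congr rfl fun l _ => ?_
    split_ifs <;> simp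
  calc _ = _ := Finset.sum_congr rfl fun j _ => Finset.sum_congr rfl fun k _ =>
        Finset.sum_congr rfl fun l _ => key j k l
    _ = _ := by
      simp only [Finset.sum_add_distrib]
      rw [s1, s2, s3, s4, t1, t2, t3, t4, t5, d2, d3]
      abel

/-- The ε₂ bound of Theorem 2:
`‖(Σ_j L_j)³ − E[3!·Â₃]‖ ≤ 8 Σ_j (1/p_j² − 1) h_j³ + 8 Σ_{j≠k} (3/p_j − 1) h_j² h_k
  + 64 Σ_{j<k<l} h_j h_k h_l`. -/
theorem stmt_14 {A : Type*} [NormedRing A] [NormedAlgebra ℂ A]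
    [CompleteSpace A] [NormOneClass A] (n : ℕ)
    (L : Fin n → A) (h : Fin n → ℝ) (hnn : ∀ j, 0 ≤ h j)
    (hL : ∀ j, ‖L j‖ ≤ 2 * h j)
    (p : Fin n → ℝ) (hp : ∀ j, p j ∈ Set.Ioc (0 : ℝ) 1) :
    ‖(∑ j : Fin n, L j) ^ 3 - sparExp p (fun b => sparT L p b)‖
      ≤ 8 * (∑ j : Fin n, (1 / (p j) ^ 2 - 1) * (h j) ^ 3)
        + 8 * (∑ j : Fin n, ∑ k : Fin n,
            (if j ≠ k then (3 / p j - 1) * (h j) ^ 2 * h k else 0))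
        + 64 * ∑ j : Fin n, ∑ k : Fin n, ∑ l : Fin n,
            (if j < k ∧ k < l then h j * h k * h l else 0) := by
  have hp0 : ∀ j, 0 < p j := fun j => (hp j).1
  have hcube : (∑ j : Fin n, L j) ^ 3 = ∑ j, ∑ k, ∑ l, L j * L k * L l := by
    rw [pow_succ, pow_two, Finset.sum_mul_sum, Finset.sum_mul]
    refine Finset.sum_congr rfl fun j _ => ?_
    rw [Finset.sum_mul]
    refine Finset.sum_congr rfl fun k _ => ?_
    rw [Finset.mul_sum]
  have hsym : (∑ j, ∑ k, (if j ≠ k then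
          (1 / p j) • (L j ^ 2 * L k) + (1 / p k) • (L j * L k ^ 2) else 0))
      = ∑ j, ∑ k, (if j ≠ k then
          (1 / p j) • (L j ^ 2 * L k) + (1 / p j) • (L k * L j ^ 2) else 0) := by
    have e1 : ∀ G H : Fin n → Fin n → A, (∑ j, ∑ k, (if j ≠ k then G j k + H j k else 0))
        = (∑ j, ∑ k, (if j ≠ k then G j k else 0)) + ∑ j, ∑ k, (if j ≠ k then H j k else 0) := by
      intro G H
      simp only [← Finset.sum_add_distrib]
      refine Finset.sum_congr rfl fun j _ => Finset.sum_congr rfl fun k _ => ?_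
      split_ifs <;> simp
    rw [e1, e1]
    congr 1
    rw [Finset.sum_comm]
    refine Finset.sum_congr rfl fun j _ => Finset.sum_congr rfl fun k _ => ?_
    simp only [ne_comm]
  have hdiff : (∑ j : Fin n, L j) ^ 3 - sparExp p (fun b => sparT L p b)
      = (∑ j, (1 - 1 / p j ^ 2) • L j ^ 3)
        + (∑ j, ∑ k, if j ≠ k then
            (1 - 3 / (2 * p j)) • (L j * L j * L k) + (1 - 3 / (2 * p j)) • (L k * L j * L j)
              + L j * L k * L j else 0)
        + ∑ j, ∑ k, ∑ l, if j < k ∧ k < l then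
            (-2 : ℝ) • (L j * L k * L l) + (-2 : ℝ) • (L l * L k * L j)
              + L j * L l * L k + L k * L j * L l + L k * L l * L j + L l * L j * L k else 0 := by
    rw [hcube, triple_split, sparExp_T L p hp0, hsym, add_sub_add_comm, add_sub_add_comm]
    simp only [Finset.smul_sum, ← Finset.sum_sub_distrib]
    congr 1
    · congr 1
      · refine Finset.sum_congr rfl fun j _ => ?_
        rw [sub_smul, one_smul, pow_three' (L j)]
      · refine Finset.sum_congr rfl fun j _ => Finset.sum_congr rfl fun k _ => ?_
        split_ifs
        · have e : (1 - 3 / (2 * p j)) = 1 - 3 / 2 * (1 / p j) := by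
            have := (hp0 j).ne'
            field_simp
          rw [e, pow_two, ← mul_assoc (L k)]
          module
        · simp
    · refine Finset.sum_congr rfl fun j _ => Finset.sum_congr rfl fun k _ =>
        Finset.sum_congr rfl fun l _ => ?_
      split_ifs
      · module
      · simp
  have hF : ∀ j k l, ‖L j * L k * L l‖ ≤ 8 * (h j * h k * h l) := by
    intro j k l
    calc ‖L j * L k * L l‖ ≤ ‖L j‖ * ‖L k‖ * ‖L l‖ := norm_mul₃_le
      _ ≤ (2 * h j) * (2 * h k) * (2 * h l) := by
        have := hnn j
        have := hnn k
        gcongr <;> apply hL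
      _ = _ := by ring
  have hsm : ∀ (c d : ℝ) (j k l), |c| ≤ d → ‖c • (L j * L k * L l)‖ ≤ d * (8 * (h j * h k * h l)) := by
    intro c d j k l hc
    rw [norm_smul, Real.norm_eq_abs]
    exact mul_le_mul hc (hF j k l) (norm_nonneg _) ((abs_nonneg _).trans hc)
  rw [hdiff]
  refine (norm_add₃_le).trans ?_
  simp only [Finset.mul_sum]
  refine add_le_add (add_le_add ?_ ?_) ?_
  · refine norm_sum_le_of_le _ fun j _ => ?_
    have h1 : (1 : ℝ) ≤ 1 / p j ^ 2 := by
      rw [le_div_iff₀ (pow_pos (hp0 j) 2), one_mul]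
      exact pow_le_one₀ (hp0 j).le (hp j).2
    have := hsm (1 - 1 / p j ^ 2) (1 / p j ^ 2 - 1) j j j
      (by rw [abs_sub_comm, abs_of_nonneg (by linarith)])
    rw [pow_three' (L j)]
    refine this.trans (le_of_eq ?_)
    ring
  · refine norm_sum_le_of_le _ fun j _ => norm_sum_le_of_le _ fun k _ => ?_
    split_ifs
    · have h1 : (1 : ℝ) ≤ 3 / (2 * p j) := by
        rw [le_div_iff₀ (by linarith [hp0 j])]
        linarith [(hp j).2]
      have hc : |1 - 3 / (2 * p j)| ≤ 3 / (2 * p j) - 1 := by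
        rw [abs_sub_comm, abs_of_nonneg (by linarith)]
      have a1 := hsm _ _ j j k hc
      have a2 := hsm _ _ k j j hc
      have a3 := hF j k j
      refine (norm_add₃_le).trans ((add_le_add (add_le_add a1 a2) a3).trans (le_of_eq ?_))
      have := (hp0 j).ne'
      field_simp
      ring
    · simp
  · refine norm_sum_le_of_le _ fun j _ => norm_sum_le_of_le _ fun k _ =>
      norm_sum_le_of_le _ fun l _ => ?_
    split_ifs
    · have hc : |(-2 : ℝ)| ≤ 2 := by norm_num
      have a1 := hsm _ _ j k l hc
      have a2 := hsm _ _ l k j hc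
      refine (norm_add_le_of_le (norm_add_le_of_le (norm_add_le_of_le (norm_add_le_of_le
        (norm_add_le_of_le a1 a2) (hF j l k)) (hF k j l)) (hF k l j)) (hF l j k)).trans
        (le_of_eq ?_)
      ring
    · simp
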